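/- Let L be a finite field extension of k = F_q(T) inside k̄ and let E be an intermediate field, k ⊆ E ⊆ L. Then the Drinfeld cogalois module Drincog(L/E) = DrinT(L/E)/E is finite. -/

import Mathlib

open Polynomial IntermediateField

noncomputable section

variable (Fq : Type) [Field Fq] [Fintype Fq]

/-- A fixed algebraic closure of the rational function field `k = Fq(T)`. -/
abbrev Kbar := AlgebraicClosure (RatFunc Fq)

/-- The Carlitz action of `T`: the `Fq`-linear map `u ↦ T•u + u^q`. -/
def carlitzT : Module.End Fq (Kbar Fq) where
  toFun u := algebraMap (RatFunc Fq) (Kbar Fq) RatFunc.X * u + u ^ Fintype.card Fq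
  map_add' u v := by
    obtain ⟨n, hp, hcard⟩ := FiniteField.card Fq (ringChar Fq)
    haveI : Fact (ringChar Fq).Prime := ⟨hp⟩
    haveI : CharP (Kbar Fq) (ringChar Fq) :=
      charP_of_injective_algebraMap (algebraMap Fq (Kbar Fq)).injective _
    show algebraMap (RatFunc Fq) (Kbar Fq) RatFunc.X * (u + v) + (u + v) ^ Fintype.card Fq =
      (algebraMap (RatFunc Fq) (Kbar Fq) RatFunc.X * u + u ^ Fintype.card Fq) +
        (algebraMap (RatFunc Fq) (Kbar Fq) RatFunc.X * v + v ^ Fintype.card Fq)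
    rw [hcard, add_pow_char_pow]
    ring
  map_smul' c u := by
    simp only [RingHom.id_apply, smul_add, mul_smul_comm, _root_.smul_pow, FiniteField.pow_card]

/-- The Carlitz module: the `Fq`-algebra morphism `Fq[T] → End_{Fq}(k̄)`
determined by `T ↦ (u ↦ T·u + u^q)`. -/
def carlitzHom : Polynomial Fq →ₐ[Fq] Module.End Fq (Kbar Fq) :=
  aeval (carlitzT Fq)

/-- The Carlitz action `C_a(u)`. -/
def carlitz (a : Polynomial Fq) (u : Kbar Fq) : Kbar Fq :=
  carlitzHom Fq a u

/-- `Λ_a = {u ∈ k̄ : C_a(u) = 0}`. -/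
def Lambda (a : Polynomial Fq) : Set (Kbar Fq) := {u | carlitz Fq a u = 0}

/-- The Carlitz torsion `μ(L)` of an intermediate field `L`. -/
def carlitzTorsion (L : IntermediateField (RatFunc Fq) (Kbar Fq)) : Set (Kbar Fq) :=
  {u | u ∈ L ∧ ∃ a : Polynomial Fq, a ≠ 0 ∧ carlitz Fq a u = 0}

/-- `DrinT(L/K) = {u ∈ L : C_m(u) ∈ K for some nonzero m}`. -/
def DrinT (K L : IntermediateField (RatFunc Fq) (Kbar Fq)) : Set (Kbar Fq) :=
  {u | u ∈ L ∧ ∃ m : Polynomial Fq, m ≠ 0 ∧ carlitz Fq m u ∈ K}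

/-- `L/K` is radical: `L = K(X)` for some `X ⊆ DrinT(L/K)`. -/
def IsRadicalC (K L : IntermediateField (RatFunc Fq) (Kbar Fq)) : Prop :=
  ∃ X ⊆ DrinT Fq K L, L = adjoin (RatFunc Fq) ((K : Set (Kbar Fq)) ∪ X)

/-- `L/K` is pure: every root in `L` of some `C_m`, `m` irreducible, lies in `K`. -/
def IsPureC (K L : IntermediateField (RatFunc Fq) (Kbar Fq)) : Prop :=
  ∀ m : Polynomial Fq, Irreducible m → ∀ u ∈ L, carlitz Fq m u = 0 → u ∈ K

/-- `L/K` is separable: every element of `L` is separable over `K`. -/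
def IsSeparableC (K L : IntermediateField (RatFunc Fq) (Kbar Fq)) : Prop :=
  ∀ u ∈ L, IsSeparable K u

/-- `L/K` is cyclotomic coradical: radical, separable and pure. -/
def IsCycloCoradicalC (K L : IntermediateField (RatFunc Fq) (Kbar Fq)) : Prop :=
  IsRadicalC Fq K L ∧ IsSeparableC Fq K L ∧ IsPureC Fq K L


set_option synthInstance.maxHeartbeats 1000000

lemma Polynomial.horner_induction {R : Type*} [Semiring R] {P : R[X] → Prop} (a : R[X])
    (zero : P 0) (step : ∀ b c, P b → P (b * X + C c)) : P a := by
  induction h : a.natDegree using Nat.strong_induction_on generalizing a with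
  | _ n ih =>
    rw [← divX_mul_X_add a]
    apply step
    rcases Nat.eq_zero_or_pos n with hn | hn
    · rw [eq_C_of_natDegree_eq_zero (h.trans hn), divX_C]
      exact zero
    · exact ih _ (by rw [natDegree_divX_eq_natDegree_tsub_one]; lia) _ rfl

lemma Polynomial.finite_setOf_natDegree_le_coeff_mem {R : Type*} [Semiring R] {S : Set R}
    (hS : S.Finite) (n : ℕ) : {p : R[X] | p.natDegree ≤ n ∧ ∀ i, p.coeff i ∈ S}.Finite := by
  refine Set.Finite.of_finite_image (f := fun p (i : Fin (n + 1)) ↦ p.coeff i)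
    ((Set.Finite.pi' fun _ ↦ hS).subset ?_) ?_
  · rintro _ ⟨p, hp, rfl⟩ i
    exact hp.2 i
  · intro p hp r hr h
    ext i
    by_cases hi : i ≤ n
    · exact congrFun h ⟨i, by lia⟩
    · rw [coeff_eq_zero_of_natDegree_lt (hp.1.trans_lt (by lia)),
        coeff_eq_zero_of_natDegree_lt (hr.1.trans_lt (by lia))]

lemma Valuation.map_coeff_multiset_prod_X_sub_C_le {R Γ : Type*} [CommRing R]
    [LinearOrderedCommGroupWithZero Γ] (v : Valuation R Γ) {M : Γ} (hM : 1 ≤ M)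
    (s : Multiset R) (hs : ∀ x ∈ s, v x ≤ M) (i : ℕ) :
    v ((s.map fun x ↦ X - C x).prod.coeff i) ≤ M ^ s.card := by
  induction s using Multiset.induction_on generalizing i with
  | empty =>
    simp only [Multiset.map_zero, Multiset.prod_zero, coeff_one, Multiset.card_zero, pow_zero]
    split_ifs <;> simp
  | cons x s ih =>
    have ih' := ih fun y hy ↦ hs y (Multiset.mem_cons_of_mem hy)
    rw [Multiset.map_cons, Multiset.prod_cons, sub_mul, coeff_sub, coeff_C_mul, Multiset.card_cons]
    refine (v.map_sub _ _).trans (max_le ?_ ?_)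
    · cases i with
      | zero => simp
      | succ i =>
        rw [coeff_X_mul]
        exact (ih' i).trans (pow_le_pow_right₀ hM (Nat.le_succ _))
    · rw [map_mul, pow_succ']
      exact mul_le_mul' (hs x (Multiset.mem_cons_self x s)) (ih' _)

lemma Valuation.map_algebraMap_eq_one_of_finite {F R Γ : Type*} [Field F] [Fintype F] [CommRing R]
    [Algebra F R] [LinearOrderedCommGroupWithZero Γ] (v : Valuation R Γ) {c : F} (hc : c ≠ 0) :
    v (algebraMap F R c) = 1 := by
  refine (pow_eq_one_iff_left (n := Fintype.card F - 1) ?_).1 ?_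
  · have := Fintype.one_lt_card (α := F)
    lia
  · rw [← map_pow, ← map_pow, FiniteField.pow_card_sub_one_eq_one c hc, map_one, map_one]

lemma Valuation.map_algebraMap_le_one_of_finite {F R Γ : Type*} [Field F] [Fintype F] [CommRing R]
    [Algebra F R] [LinearOrderedCommGroupWithZero Γ] (v : Valuation R Γ) (c : F) :
    v (algebraMap F R c) ≤ 1 := by
  rcases eq_or_ne c 0 with rfl | hc
  · simp
  · exact (v.map_algebraMap_eq_one_of_finite hc).le

lemma Valuation.map_aeval_eq_pow_natDegree {F R Γ : Type*} [Field F] [Fintype F] [CommRing R]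
    [Algebra F R] [LinearOrderedCommGroupWithZero Γ] (v : Valuation R Γ) {t : R} (ht : 1 < v t)
    (a : F[X]) (ha : a ≠ 0) : v (aeval t a) = v t ^ a.natDegree := by
  induction a using Polynomial.horner_induction with
  | zero => exact absurd rfl ha
  | step b c ih =>
    rcases eq_or_ne b 0 with rfl | hb
    · have hc : c ≠ 0 := by rintro rfl; simp at ha
      simp [v.map_algebraMap_eq_one_of_finite hc]
    · have hlt : v (algebraMap F R c) < v (aeval t b * t) := by
        refine (v.map_algebraMap_le_one_of_finite c).trans_lt ?_
        rw [map_mul, ih hb, ← pow_succ]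
        exact one_lt_pow₀ ht (Nat.succ_ne_zero _)
      rw [natDegree_add_C, natDegree_mul_X hb, map_add, map_mul, aeval_X, aeval_C,
        v.map_add_eq_of_lt_left hlt, map_mul, ih hb, pow_succ]

/-- An element of a field is integral over `A` if it lies in every valuation subring
containing the image of `A`. -/
lemma isIntegral_of_forall_mem_valuationSubring {A K : Type*} [CommRing A] [Field K] [Algebra A K]
    {x : K} (h : ∀ V : ValuationSubring K, (∀ a, algebraMap A K a ∈ V) → x ∈ V) :
    IsIntegral A x := by
  have hx : x ∈ (integralClosure
      (Subring.closure ((algebraMap A K).range : Set K)) K).toSubring := by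
    rw [← iInf_valuationSubring_superset, Subring.mem_iInf]
    rintro ⟨V, hV⟩
    exact h V fun a ↦ hV ⟨a, rfl⟩
  rw [Subring.closure_eq] at hx
  obtain ⟨P, hP, hPx⟩ : IsIntegral (algebraMap A K).range x := hx
  obtain ⟨Q, hQ, -, hQm⟩ := lifts_and_natDegree_eq_and_monic
    ((mem_lifts _).2 (map_surjective _ (algebraMap A K).rangeRestrict_surjective P)) hP
  refine ⟨Q, hQm, ?_⟩
  rw [← hQ, eval₂_map] at hPx
  exact hPx

lemma carlitz_sub (a : Polynomial Fq) (u v : Kbar Fq) :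
    carlitz Fq a (u - v) = carlitz Fq a u - carlitz Fq a v :=
  map_sub (carlitzHom Fq a) u v

lemma carlitz_mul (a b : Polynomial Fq) (u : Kbar Fq) :
    carlitz Fq (a * b) u = carlitz Fq a (carlitz Fq b u) := by
  simp only [carlitz, map_mul, Module.End.mul_apply]

lemma carlitz_mul_X_add_C (b : Polynomial Fq) (c : Fq) (u : Kbar Fq) :
    carlitz Fq (b * X + C c) u =
      algebraMap (RatFunc Fq) (Kbar Fq) RatFunc.X * carlitz Fq b u +
        carlitz Fq b u ^ Fintype.card Fq + algebraMap Fq (Kbar Fq) c * u := by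
  rw [mul_comm b]
  simp only [carlitz, map_add, map_mul, LinearMap.add_apply, Module.End.mul_apply]
  congr 1
  · rw [carlitzHom, aeval_X]
    rfl
  · rw [carlitzHom, aeval_C, Module.algebraMap_end_apply, Algebra.smul_def]

/-- The action `C_a` is given by a polynomial whose derivative is the constant `a`. -/
lemma exists_carlitz_eq_aeval (a : Polynomial Fq) :
    ∃ G : Polynomial (RatFunc Fq), (∀ u, carlitz Fq a u = aeval u G) ∧
      derivative G = C (algebraMap (Polynomial Fq) (RatFunc Fq) a) := by
  induction a using Polynomial.horner_induction with
  | zero => exact ⟨0, fun u ↦ by simp [carlitz], by simp⟩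
  | step b c ih =>
    obtain ⟨G, hG, hG'⟩ := ih
    have hq : (Fintype.card Fq : RatFunc Fq) = 0 := by
      rw [← map_natCast (algebraMap Fq (RatFunc Fq)), Nat.cast_card_eq_zero, map_zero]
    refine ⟨C RatFunc.X * G + G ^ Fintype.card Fq + C (algebraMap Fq (RatFunc Fq) c) * X,
      fun u ↦ ?_, ?_⟩
    · rw [carlitz_mul_X_add_C, hG]
      simp only [map_add, map_mul, map_pow, aeval_C, aeval_X,
        ← IsScalarTower.algebraMap_apply]
    · simp only [derivative_C_mul, derivative_pow, derivative_X, hG', hq, mul_one,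
        map_zero, zero_mul, add_zero, map_add, map_mul, RatFunc.algebraMap_X, RatFunc.algebraMap_C]
      rw [mul_comm (C RatFunc.X)]
      rfl

lemma carlitz_mem {E : IntermediateField (RatFunc Fq) (Kbar Fq)} (a : Polynomial Fq)
    {u : Kbar Fq} (hu : u ∈ E) : carlitz Fq a u ∈ E := by
  obtain ⟨G, hG, -⟩ := exists_carlitz_eq_aeval Fq a
  rw [hG]
  exact aeval_algHom_apply E.val ⟨u, hu⟩ G ▸ (aeval (⟨u, hu⟩ : E) G).2

lemma map_carlitz_of_mem {L : IntermediateField (RatFunc Fq) (Kbar Fq)}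
    (φ : L →ₐ[RatFunc Fq] Kbar Fq) (a : Polynomial Fq) (u : L) (h : carlitz Fq a u ∈ L) :
    φ ⟨carlitz Fq a u, h⟩ = carlitz Fq a (φ u) := by
  obtain ⟨G, hG, -⟩ := exists_carlitz_eq_aeval Fq a
  rw [hG (φ u), aeval_algHom_apply]
  congr 1
  exact Subtype.ext ((hG u).trans (aeval_algHom_apply L.val u G))

lemma map_carlitz (σ : Kbar Fq ≃ₐ[RatFunc Fq] Kbar Fq) (a : Polynomial Fq) (u : Kbar Fq) :
    σ (carlitz Fq a u) = carlitz Fq a (σ u) := by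
  obtain ⟨G, hG, -⟩ := exists_carlitz_eq_aeval Fq a
  rw [hG, hG]
  exact (aeval_algHom_apply σ.toAlgHom u G).symm

lemma isSeparable_of_carlitz_mem {E : IntermediateField (RatFunc Fq) (Kbar Fq)}
    {a : Polynomial Fq} (ha : a ≠ 0) {u : Kbar Fq} (hu : carlitz Fq a u ∈ E) :
    IsSeparable E u := by
  obtain ⟨G, hG, hG'⟩ := exists_carlitz_eq_aeval Fq a
  set H : Polynomial E := G.map (algebraMap (RatFunc Fq) E) - C ⟨_, hu⟩ with hH
  have hsep : H.Separable := by
    have : derivative H = C (algebraMap (RatFunc Fq) E (algebraMap _ _ a)) := by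
      simp [hH, derivative_map, hG']
    rw [separable_def, this]
    have hu : IsUnit (C (algebraMap (RatFunc Fq) E (algebraMap _ _ a))) := by
      rw [isUnit_C, isUnit_iff_ne_zero]
      simpa using ha
    obtain ⟨w, hw⟩ := hu.exists_left_inv
    exact ⟨0, w, by rw [zero_mul, zero_add, hw]⟩
  refine hsep.of_dvd (minpoly.dvd E u ?_)
  rw [hH, map_sub, aeval_map_algebraMap, ← hG, aeval_C]
  exact sub_self _

lemma mem_of_carlitz_mem_of_forall_map_eq {E L : IntermediateField (RatFunc Fq) (Kbar Fq)}
    {a : Polynomial Fq} (ha : a ≠ 0) {u : L} (hu : carlitz Fq a u ∈ E)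
    (hφ : ∀ φ : L →ₐ[RatFunc Fq] Kbar Fq, (∀ e : L, (e : Kbar Fq) ∈ E → φ e = e) → φ u = u) :
    (u : Kbar Fq) ∈ E := by
  have hsep := isSeparable_of_carlitz_mem Fq ha hu
  have hroots : ∀ y ∈ ((minpoly E (u : Kbar Fq)).aroots (Kbar Fq)), y = u := by
    intro y hy
    obtain ⟨σ, rfl⟩ := minpoly.exists_algEquiv_of_root' (Algebra.IsAlgebraic.isAlgebraic _)
      (mem_aroots.1 hy).2
    exact hφ ((σ.restrictScalars (RatFunc Fq)).toAlgHom.comp L.val)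
      fun e he ↦ σ.commutes ⟨e, he⟩
  have hcard : ((minpoly E (u : Kbar Fq)).aroots (Kbar Fq)).card ≤ 1 := by
    classical
    rw [← Multiset.count_eq_card.2 fun y hy ↦ (hroots y hy).symm]
    exact Multiset.nodup_iff_count_le_one.1 (nodup_roots (Separable.map hsep)) _
  rw [← (IsAlgClosed.splits _).natDegree_eq_card_roots, natDegree_map] at hcard
  have hint : IsIntegral E (u : Kbar Fq) := Algebra.IsIntegral.isIntegral _
  obtain ⟨e, he⟩ := minpoly.natDegree_eq_one_iff.1 (hcard.antisymm (minpoly.natDegree_pos hint))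
  exact he ▸ e.2

lemma le_valuation_carlitz {Γ : Type*} [LinearOrderedCommGroupWithZero Γ]
    (v : Valuation (Kbar Fq) Γ) {u : Kbar Fq} (h1 : 1 < v u)
    (hT : v (algebraMap (RatFunc Fq) (Kbar Fq) RatFunc.X) < v u)
    (a : Polynomial Fq) (ha : a ≠ 0) : v u ≤ v (carlitz Fq a u) := by
  induction a using Polynomial.horner_induction with
  | zero => exact absurd rfl ha
  | step b c ih =>
    rw [carlitz_mul_X_add_C]
    rcases eq_or_ne b 0 with rfl | hb
    · have hc : c ≠ 0 := by rintro rfl; simp at ha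
      simp [carlitz, v.map_algebraMap_eq_one_of_finite hc]
    · set y := carlitz Fq b u
      have hy := ih hb
      have hy0 : 0 < v y := (zero_lt_one.trans h1).trans_le hy
      have h2 : v y * v y ≤ v (y ^ Fintype.card Fq) := by
        rw [map_pow, ← pow_two]
        exact pow_le_pow_right₀ (h1.le.trans hy) Fintype.one_lt_card
      have h3 : v (algebraMap (RatFunc Fq) (Kbar Fq) RatFunc.X * y) < v (y ^ Fintype.card Fq) := by
        refine lt_of_lt_of_le ?_ h2
        rw [map_mul]
        exact mul_lt_mul_of_pos_right (hT.trans_le hy) hy0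
      have h4 : v u < v (y ^ Fintype.card Fq) := by
        refine lt_of_lt_of_le ?_ h2
        exact hy.trans_lt (lt_mul_of_one_lt_left hy0 (h1.trans_le hy))
      have h5 : v (algebraMap Fq (Kbar Fq) c * u) ≤ v u := by
        rw [map_mul]
        exact mul_le_of_le_one_left' (v.map_algebraMap_le_one_of_finite c)
      rw [add_comm (_ * y), add_assoc, v.map_add_eq_of_lt_left]
      · exact h4.le
      · exact v.map_add_lt h3 (h5.trans_lt h4)

lemma valuation_le_of_carlitz_eq_zero {Γ : Type*} [LinearOrderedCommGroupWithZero Γ]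
    (v : Valuation (Kbar Fq) Γ) {u : Kbar Fq} {a : Polynomial Fq} (ha : a ≠ 0)
    (hu : carlitz Fq a u = 0) :
    v u ≤ max 1 (v (algebraMap (RatFunc Fq) (Kbar Fq) RatFunc.X)) := by
  by_contra! h
  have := le_valuation_carlitz Fq v ((le_max_left _ _).trans_lt h) ((le_max_right _ _).trans_lt h)
    a ha
  rw [hu, map_zero] at this
  exact not_lt_of_ge this (zero_lt_one.trans ((le_max_left _ _).trans_lt h))

lemma algebraMap_eq_aeval {F : Type} [Field F] (a : Polynomial F) :
    algebraMap (Polynomial F) (Kbar F) a =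
      aeval (algebraMap (RatFunc F) (Kbar F) RatFunc.X) a := by
  rw [aeval_algebraMap_apply, ← RatFunc.algebraMap_X, aeval_algebraMap_apply, aeval_X_left_apply,
    ← IsScalarTower.algebraMap_apply]

lemma isIntegral_of_carlitz_eq_zero {u : Kbar Fq} {a : Polynomial Fq} (ha : a ≠ 0)
    (hu : carlitz Fq a u = 0) : IsIntegral (Polynomial Fq) u := by
  refine isIntegral_of_forall_mem_valuationSubring fun V hV ↦ (V.valuation_le_one_iff u).1 ?_
  refine (valuation_le_of_carlitz_eq_zero Fq V.valuation ha hu).trans (max_le le_rfl ?_)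
  refine (V.valuation_le_one_iff _).2 ?_
  simpa [algebraMap_eq_aeval] using hV X

/-- There is a valuation on `k̄` that is nontrivial at infinity. -/
lemma exists_one_lt_valuation_X (F : Type) [Field F] : ∃ V : ValuationSubring (Kbar F),
    1 < V.valuation (algebraMap (RatFunc F) (Kbar F) RatFunc.X) := by
  by_contra! h
  have hint : IsIntegral F (algebraMap (RatFunc F) (Kbar F) RatFunc.X) :=
    isIntegral_of_forall_mem_valuationSubring fun V _ ↦ (V.valuation_le_one_iff _).1 (h V)
  exact (transcendental_algebraMap_iff (algebraMap (RatFunc F) (Kbar F)).injective).2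
    RatFunc.transcendental_X hint.isAlgebraic

lemma natDegree_coeff_minpoly_le {u : Kbar Fq} {a : Polynomial Fq} (ha : a ≠ 0)
    (hu : carlitz Fq a u = 0) (i : ℕ) :
    ((minpoly (Polynomial Fq) u).coeff i).natDegree ≤ (minpoly (RatFunc Fq) u).natDegree := by
  have hint := isIntegral_of_carlitz_eq_zero Fq ha hu
  obtain ⟨V, hV⟩ := exists_one_lt_valuation_X Fq
  set P := (minpoly (RatFunc Fq) u).map (algebraMap _ (Kbar Fq)) with hP
  have hsplit : P.Splits := IsAlgClosed.splits P
  have hroot : ∀ x ∈ P.roots,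
      V.valuation x ≤ V.valuation (algebraMap (RatFunc Fq) (Kbar Fq) RatFunc.X) := by
    intro x hx
    obtain ⟨σ, rfl⟩ := minpoly.exists_algEquiv_of_root' (Algebra.IsAlgebraic.isAlgebraic u)
      (mem_aroots.1 hx).2
    have hσ : carlitz Fq a (σ u) = 0 := by rw [← map_carlitz, hu, map_zero]
    exact (valuation_le_of_carlitz_eq_zero Fq V.valuation ha hσ).trans (max_le hV.le le_rfl)
  have hmonic : P.Monic := (minpoly.monic hint.tower_top).map _
  have hle := V.valuation.map_coeff_multiset_prod_X_sub_C_le hV.le P.roots hroot i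
  rw [← hsplit.eq_prod_roots_of_monic hmonic, ← hsplit.natDegree_eq_card_roots, hP, natDegree_map,
    minpoly.isIntegrallyClosed_eq_field_fractions' (RatFunc Fq) hint, coeff_map, coeff_map,
    ← IsScalarTower.algebraMap_apply, algebraMap_eq_aeval] at hle
  rw [minpoly.isIntegrallyClosed_eq_field_fractions' (RatFunc Fq) hint]
  rcases eq_or_ne ((minpoly (Polynomial Fq) u).coeff i) 0 with h0 | h0
  · simp [h0]
  · rw [V.valuation.map_aeval_eq_pow_natDegree hV _ h0] at hle
    exact (pow_le_pow_iff_right₀ hV).1 hle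

lemma finite_carlitzTorsion (N : IntermediateField (RatFunc Fq) (Kbar Fq))
    [FiniteDimensional (RatFunc Fq) N] : (carlitzTorsion Fq N).Finite := by
  set D := Module.finrank (RatFunc Fq) N
  have hfin : {a : Polynomial Fq | a.natDegree ≤ D}.Finite := by
    simpa using Polynomial.finite_setOf_natDegree_le_coeff_mem (Set.finite_univ (α := Fq)) D
  refine ((Polynomial.finite_setOf_natDegree_le_coeff_mem hfin D).biUnion
    fun P _ ↦ P.rootSet_finite (Kbar Fq)).subset ?_
  rintro u ⟨huN, a, ha, hu⟩
  have hint := isIntegral_of_carlitz_eq_zero Fq ha hu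
  have hD : (minpoly (RatFunc Fq) u).natDegree ≤ D := by
    have := minpoly.natDegree_le (A := RatFunc Fq) (⟨u, huN⟩ : N)
    rwa [← minpoly.algebraMap_eq (algebraMap N (Kbar Fq)).injective] at this
  have hmap : (minpoly (RatFunc Fq) u).natDegree = (minpoly (Polynomial Fq) u).natDegree := by
    rw [minpoly.isIntegrallyClosed_eq_field_fractions' (RatFunc Fq) hint,
      (minpoly.monic hint).natDegree_map]
  refine Set.mem_biUnion (x := minpoly (Polynomial Fq) u)
    ⟨hmap ▸ hD, fun i ↦ (natDegree_coeff_minpoly_le Fq ha hu i).trans hD⟩ ?_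
  exact mem_rootSet'.2 ⟨((minpoly.monic hint).map _).ne_zero, minpoly.aeval _ _⟩

/-- For a finite extension `L/k` inside `k̄` and an intermediate field
`k ⊆ E ⊆ L`, the Drinfeld cogalois module `Drincog(L/E) = DrinT(L/E)/E`, realized as the
image of `DrinT(L/E)` in the additive quotient group `k̄/E`, is finite. -/
theorem drincog_finite (E L : IntermediateField (RatFunc Fq) (Kbar Fq)) (hEL : E ≤ L)
    [FiniteDimensional (RatFunc Fq) L] :
    ((QuotientAddGroup.mk (s := E.toSubfield.toSubring.toAddSubgroup)) ''
      (DrinT Fq E L)).Finite := by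
  set N := normalClosure (RatFunc Fq) L (Kbar Fq)
  let Φ := {φ : L →ₐ[RatFunc Fq] Kbar Fq // ∀ e : L, (e : Kbar Fq) ∈ E → φ e = e}
  let g : L → Φ → Kbar Fq := fun u φ ↦ φ.1 u - u
  set S : Set L := {u | (u : Kbar Fq) ∈ DrinT Fq E L}
  have hgfin : (g '' S).Finite := by
    refine (Set.Finite.pi' fun _ : Φ ↦ finite_carlitzTorsion Fq N).subset ?_
    rintro _ ⟨u, ⟨-, m, hm, hmu⟩, rfl⟩ φ
    refine ⟨sub_mem (φ.1.fieldRange_le_normalClosure ⟨u, rfl⟩)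
      (L.val.fieldRange_le_normalClosure ⟨u, rfl⟩), m, hm, ?_⟩
    rw [carlitz_sub, ← map_carlitz_of_mem Fq φ.1 m u (hEL hmu), φ.2 _ hmu, sub_self]
  have hinj : ∀ u ∈ S, ∀ w ∈ S, g u = g w → (-(u : Kbar Fq) + w) ∈ E := by
    rintro u ⟨-, m, hm, hmu⟩ w ⟨-, n, hn, hnw⟩ h
    have hmem : carlitz Fq (m * n) ((w - u : L) : Kbar Fq) ∈ E := by
      rw [AddSubgroupClass.coe_sub, carlitz_sub, carlitz_mul, mul_comm, carlitz_mul]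
      exact sub_mem (carlitz_mem Fq m hnw) (carlitz_mem Fq n hmu)
    rw [neg_add_eq_sub]
    refine mem_of_carlitz_mem_of_forall_map_eq Fq (mul_ne_zero hm hn) hmem fun φ hφ ↦ ?_
    have := congrFun h ⟨φ, hφ⟩
    rw [map_sub, AddSubgroupClass.coe_sub]
    exact sub_eq_sub_iff_sub_eq_sub.1 this.symm
  refine (hgfin.image fun f ↦ (QuotientAddGroup.mk ((Function.invFunOn g S f : L) : Kbar Fq) :
    Kbar Fq ⧸ E.toSubfield.toSubring.toAddSubgroup)).subset ?_
  rintro _ ⟨u, hu, rfl⟩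
  have huS : (⟨u, hu.1⟩ : L) ∈ S := hu
  have hex : ∃ w ∈ S, g w = g ⟨u, hu.1⟩ := ⟨_, huS, rfl⟩
  refine ⟨g ⟨u, hu.1⟩, ⟨_, huS, rfl⟩, QuotientAddGroup.eq.2 ?_⟩
  exact hinj _ (Function.invFunOn_mem hex) ⟨u, hu.1⟩ huS (Function.invFunOn_eq hex)

end
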